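/- Let n ≥ 4 and u ∈ W^{1,∞}(S^{n-1}) with ∫_{S^{n-1}} u dH^{n-1} = 0. Then there exists C(n) > 0 such that ‖u‖_{L^∞}^{n-1} ≤ C(n) ‖∇_τ u‖_{L^2}² ‖∇_τ u‖_{L^∞}^{n-3}. -/

import Mathlib

open Metric MeasureTheory
open scoped RealInnerProductSpace

section Fan

variable {W : Type*} [NormedAddCommGroup W] [NormedSpace ℝ W] [FiniteDimensional ℝ W]
  [MeasurableSpace W] [BorelSpace W] (μ : Measure W) [μ.IsAddHaarMeasure]

/-- Contracting a convex compact set towards one of its points by the factor `t` increases the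
average of a nonnegative function by at most `t⁻ᵈ`. -/
theorem setIntegral_comp_contraction_le {K : Set W} (hK : IsCompact K) (hc : Convex ℝ K)
    {f : W → ℝ} (hf : Continuous f) (h0 : ∀ y, 0 ≤ f y) {x : W} (hx : x ∈ K) {t : ℝ}
    (ht : 0 < t) (ht1 : t ≤ 1) :
    ∫ z in K, f (x + t • (z - x)) ∂μ ≤ (t ^ Module.finrank ℝ W)⁻¹ * ∫ z in K, f z ∂μ := by
  have hm := hK.isClosed.measurableSet
  set g : W → ℝ := K.indicator f
  have hg : Integrable g μ :=
    (integrable_indicator_iff hm).2 (hf.continuousOn.integrableOn_compact hK)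
  have e : ∀ z, x + t • (z - x) = (x - t • x) + t • z := fun z => by rw [smul_sub]; abel
  have hgi : Integrable (fun z => g (x + t • (z - x))) μ := by
    simp_rw [e]
    exact (hg.comp_add_left (x - t • x)).comp_smul ht.ne'
  have hg0 : ∀ z, 0 ≤ g z := fun z => Set.indicator_nonneg (fun y _ => h0 y) z
  calc ∫ z in K, f (x + t • (z - x)) ∂μ = ∫ z in K, g (x + t • (z - x)) ∂μ := by
        refine setIntegral_congr_fun hm fun z hz => ?_
        have : x + t • (z - x) ∈ K := hc.add_smul_sub_mem hx hz ⟨ht.le, ht1⟩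
        simp [g, this]
    _ ≤ ∫ z, g (x + t • (z - x)) ∂μ :=
        setIntegral_le_integral hgi (Filter.Eventually.of_forall fun z => hg0 _)
    _ = (t ^ Module.finrank ℝ W)⁻¹ * ∫ z, g z ∂μ := by
        simp_rw [e]
        rw [Measure.integral_comp_smul μ (fun y => g (x - t • x + y)) t,
          integral_add_left_eq_self, abs_of_nonneg (by positivity), smul_eq_mul]
    _ = _ := by rw [integral_indicator hm]

/-- The integral of `G` along the segments issuing from `x`, averaged over their endpoints in `K`,
is controlled by interpolating between the bound `L` and the integral of `G ^ 2`. -/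
theorem integral_fan_le (hd : 3 ≤ Module.finrank ℝ W) {K : Set W} (hK : IsCompact K)
    (hc : Convex ℝ K) {G : W → ℝ} (hG : Continuous G) {x : W}
    (hx : x ∈ K) {L τ : ℝ} (hL : 0 < L) (hτ : 0 < τ) (hGL : ∀ y ∈ K, G y ≤ L)
    (hI : ∫ z in K, G z ^ 2 ∂μ ≤ τ ^ Module.finrank ℝ W * L ^ 2) :
    ∫ t in (0 : ℝ)..1, ∫ z in K, G (x + t • (z - x)) ∂μ ≤ (2 * μ.real K + 1) * (L * τ) := by
  have hm := hK.isClosed.measurableSet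
  set h : ℝ → ℝ := fun t => ∫ z in K, G (x + t • (z - x)) ∂μ
  have hfin : μ K ≠ ⊤ := hK.measure_ne_top
  have hcont : Continuous h :=
    continuous_parametric_integral_of_continuous (f := fun (t : ℝ) z => G (x + t • (z - x)))
      (by fun_prop) hK
  have hint : ∀ t : ℝ, IntegrableOn (fun z => G (x + t • (z - x))) K μ := fun t =>
    (by fun_prop : Continuous fun z => G (x + t • (z - x))).continuousOn.integrableOn_compact hK
  have hint2 : ∀ t : ℝ, IntegrableOn (fun z => G (x + t • (z - x)) ^ 2) K μ := fun t =>
    (by fun_prop :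
      Continuous fun z => G (x + t • (z - x)) ^ 2).continuousOn.integrableOn_compact hK
  have hμ0 : 0 ≤ μ.real K := measureReal_nonneg
  have h1 : ∀ t ∈ Set.Icc (0 : ℝ) 1, h t ≤ L * μ.real K := fun t ht => by
    have : h t ≤ ∫ _ in K, L ∂μ :=
      setIntegral_mono_on (hint t) (integrableOn_const hfin) hm
        fun z hz => hGL _ (hc.add_smul_sub_mem hx hz ht)
    simpa [mul_comm] using this
  have h2 : ∀ t ∈ Set.Ioc (0 : ℝ) 1, ∀ a > 0,
      h t ≤ a / 2 * μ.real K + (2 * a)⁻¹ * ((t ^ Module.finrank ℝ W)⁻¹ *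
        ∫ z in K, G z ^ 2 ∂μ) := fun t ht a ha => by
    have h3 : h t ≤ ∫ z in K, (a / 2 + (2 * a)⁻¹ * G (x + t • (z - x)) ^ 2) ∂μ := by
      refine setIntegral_mono_on (hint t)
        (Integrable.add (integrableOn_const hfin) ((hint2 t).const_mul _)) hm fun z hz => ?_
      set y := G (x + t • (z - x))
      have : a / 2 + (2 * a)⁻¹ * y ^ 2 - y = (2 * a)⁻¹ * (y - a) ^ 2 := by field_simp; ring
      have : 0 ≤ (2 * a)⁻¹ * (y - a) ^ 2 := by positivity
      linarith
    rw [integral_add (integrableOn_const hfin).integrable ((hint2 t).const_mul _),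
      integral_const_mul, setIntegral_const, smul_eq_mul, mul_comm (μ.real K)] at h3
    refine h3.trans ?_
    gcongr
    exact setIntegral_comp_contraction_le μ hK hc (f := fun y => G y ^ 2) (by fun_prop)
      (fun y => sq_nonneg _) hx ht.1 ht.2
  rcases le_total 1 τ with h1τ | hτ1
  · calc ∫ t in (0 : ℝ)..1, h t ≤ ∫ t in (0 : ℝ)..1, L * μ.real K :=
          intervalIntegral.integral_mono_on zero_le_one (hcont.intervalIntegrable _ _)
            (by simp) h1
      _ = μ.real K * (L * 1) := by simp [mul_comm]
      _ ≤ (2 * μ.real K + 1) * (L * τ) := by gcongr; linarith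
  · have h3 : ∀ t ∈ Set.Icc τ 1,
        h t ≤ (L * (μ.real K + 1) / 2 * τ ^ (3 / 2 : ℝ)) * t ^ (-(3 / 2) : ℝ) := fun t ht => by
      have ht0 : 0 < t := hτ.trans_le ht.1
      set q := τ ^ (3 / 2 : ℝ) * t ^ (-(3 / 2) : ℝ) with hq
      have hq0 : 0 < q := by positivity
      have hq2 : q ^ 2 = (τ / t) ^ 3 := by
        have : q = (τ / t) ^ (3 / 2 : ℝ) := by
          rw [hq, Real.div_rpow hτ.le ht0.le, Real.rpow_neg ht0.le]
          exact (div_eq_mul_inv _ _).symm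
        rw [this, ← Real.rpow_natCast, ← Real.rpow_natCast (τ / t) 3,
          ← Real.rpow_mul (by positivity)]
        norm_num
      have hle : (τ / t) ^ Module.finrank ℝ W ≤ q ^ 2 := by
        rw [hq2]
        exact pow_le_pow_of_le_one (by positivity) ((div_le_one ht0).2 ht.1) hd
      have := h2 t ⟨ht0, ht.2⟩ (L * q) (by positivity)
      calc h t ≤ _ := this
        _ ≤ L * q / 2 * μ.real K + (2 * (L * q))⁻¹ * ((t ^ Module.finrank ℝ W)⁻¹ *
              (τ ^ Module.finrank ℝ W * L ^ 2)) := by gcongr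
        _ = L * q / 2 * μ.real K +
              (2 * (L * q))⁻¹ * ((τ / t) ^ Module.finrank ℝ W * L ^ 2) := by
            rw [div_pow]; ring
        _ ≤ L * q / 2 * μ.real K + (2 * (L * q))⁻¹ * (q ^ 2 * L ^ 2) := by gcongr
        _ = L * (μ.real K + 1) / 2 * q := by field_simp
        _ = _ := by rw [hq]; ring
    have hnot : (0 : ℝ) ∉ Set.uIcc τ 1 := by
      rw [Set.uIcc_of_le hτ1]; exact fun hh => absurd hh.1 (not_le.2 hτ)
    have h4 : ∫ t in τ..1, h t ≤ L * (μ.real K + 1) * τ := by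
      calc ∫ t in τ..1, h t ≤ ∫ t in τ..1,
            (L * (μ.real K + 1) / 2 * τ ^ (3 / 2 : ℝ)) * t ^ (-(3 / 2) : ℝ) :=
            intervalIntegral.integral_mono_on hτ1 (hcont.intervalIntegrable _ _)
              ((intervalIntegral.intervalIntegrable_rpow (Or.inr hnot)).const_mul _) h3
        _ = (L * (μ.real K + 1) / 2 * τ ^ (3 / 2 : ℝ)) * (2 * (τ ^ (-(1 / 2) : ℝ) - 1)) := by
            rw [intervalIntegral.integral_const_mul, integral_rpow (Or.inr ⟨by norm_num, hnot⟩)]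
            norm_num
            left; ring
        _ ≤ (L * (μ.real K + 1) / 2 * τ ^ (3 / 2 : ℝ)) * (2 * (τ ^ (-(1 / 2) : ℝ))) := by
            gcongr; linarith
        _ = L * (μ.real K + 1) * (τ ^ (3 / 2 : ℝ) * τ ^ (-(1 / 2) : ℝ)) := by ring
        _ = _ := by rw [← Real.rpow_add hτ]; norm_num
    have h5 : ∫ t in (0 : ℝ)..τ, h t ≤ τ * (L * μ.real K) := by
      calc ∫ t in (0 : ℝ)..τ, h t ≤ ∫ t in (0 : ℝ)..τ, L * μ.real K :=
            intervalIntegral.integral_mono_on hτ.le (hcont.intervalIntegrable _ _)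
              (by simp) fun t ht => h1 t ⟨ht.1, ht.2.trans hτ1⟩
        _ = _ := by simp; ring
    rw [← intervalIntegral.integral_add_adjacent_intervals (hcont.intervalIntegrable 0 τ)
      (hcont.intervalIntegrable τ 1)]
    linarith

/-- Morrey-type estimate: a function whose increments along the segments of a convex compact set
`K` are controlled by line integrals of `G` oscillates on `K` by at most a multiple of `L * τ`,
where `L` bounds `G` and `τ ^ d * L ^ 2` bounds the integral of `G ^ 2`. -/
theorem oscillation_le_of_segment_integral_le (hd : 3 ≤ Module.finrank ℝ W) {K : Set W}
    (hK : IsCompact K) (hc : Convex ℝ K) (hμK : μ K ≠ 0) {G v : W → ℝ} (hG : Continuous G)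
    (hv : Continuous v) {D : ℝ} (hD : 0 ≤ D)
    (hvG : ∀ x ∈ K, ∀ z ∈ K, |v z - v x| ≤ D * ∫ t in (0 : ℝ)..1, G (x + t • (z - x)))
    {L τ : ℝ} (hL : 0 < L) (hτ : 0 < τ) (hGL : ∀ y ∈ K, G y ≤ L)
    (hI : ∫ z in K, G z ^ 2 ∂μ ≤ τ ^ Module.finrank ℝ W * L ^ 2) {x y : W} (hx : x ∈ K)
    (hy : y ∈ K) :
    |v x - v y| ≤ 2 * D * (2 * μ.real K + 1) / μ.real K * (L * τ) := by
  have hm := hK.isClosed.measurableSet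
  have hfin : μ K ≠ ⊤ := hK.measure_ne_top
  have hpos : 0 < μ.real K := ENNReal.toReal_pos hμK hfin
  have key : ∀ x ∈ K, ∫ z in K, |v z - v x| ∂μ ≤ D * ((2 * μ.real K + 1) * (L * τ)) := by
    intro x hx
    have hsw : ∫ t in (0 : ℝ)..1, ∫ z in K, G (x + t • (z - x)) ∂μ =
        ∫ z in K, (∫ t in (0 : ℝ)..1, G (x + t • (z - x))) ∂μ := by
      refine intervalIntegral_integral_swap (f := fun (t : ℝ) z => G (x + t • (z - x))) ?_
      rw [Measure.prod_restrict]
      have hc2 : Continuous (Function.uncurry fun (t : ℝ) z => G (x + t • (z - x))) := by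
        fun_prop
      have := hc2.continuousOn.integrableOn_compact (μ := (volume : Measure ℝ).prod μ)
        ((isCompact_Icc (a := (0 : ℝ)) (b := 1)).prod hK)
      refine this.mono_set (Set.prod_mono ?_ le_rfl)
      rw [Set.uIoc_of_le zero_le_one]
      exact Set.Ioc_subset_Icc_self
    have hcz : Continuous fun z => ∫ t in (0 : ℝ)..1, G (x + t • (z - x)) :=
      intervalIntegral.continuous_parametric_intervalIntegral_of_continuous'
        (f := fun z (t : ℝ) => G (x + t • (z - x))) (by fun_prop) 0 1
    calc ∫ z in K, |v z - v x| ∂μ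
        ≤ ∫ z in K, D * (∫ t in (0 : ℝ)..1, G (x + t • (z - x))) ∂μ :=
          setIntegral_mono_on
            ((by fun_prop : Continuous fun z => |v z - v x|).continuousOn.integrableOn_compact hK)
            ((hcz.const_mul D).continuousOn.integrableOn_compact hK) hm
            fun z hz => hvG x hx z hz
      _ ≤ _ := by
          rw [integral_const_mul, ← hsw]
          gcongr
          exact integral_fan_le μ hd hK hc hG hx hL hτ hGL hI
  have hi : ∀ x, IntegrableOn (fun z => |v z - v x|) K μ := fun x =>
    (by fun_prop : Continuous fun z => |v z - v x|).continuousOn.integrableOn_compact hK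
  have hsum : ∫ _ in K, |v x - v y| ∂μ ≤ ∫ z in K, (|v z - v x| + |v z - v y|) ∂μ :=
    setIntegral_mono_on (integrableOn_const hfin) ((hi x).add (hi y)) hm fun z _ => by
      rw [abs_sub_comm (v z) (v x)]
      exact abs_sub_le _ _ _
  rw [integral_add (hi x) (hi y), setIntegral_const, smul_eq_mul] at hsum
  have := key x hx
  have := key y hy
  rw [div_mul_eq_mul_div, le_div_iff₀ hpos]
  linarith

end Fan

theorem mem_closedBall_sqrt_half {V : Type*} [SeminormedAddCommGroup V] {x : V} :
    x ∈ closedBall (0 : V) √(1 / 2) ↔ ‖x‖ ^ 2 ≤ 1 / 2 := by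
  rw [mem_closedBall_zero_iff, Real.le_sqrt (norm_nonneg _) (by norm_num)]

section SphereGraph

open Set

variable {E W : Type*} [NormedAddCommGroup E] [InnerProductSpace ℝ E]
  [NormedAddCommGroup W] [InnerProductSpace ℝ W]

/-- The upper unit hemisphere with pole `e`, as a graph over the hyperplane spanned by `ι`. -/
noncomputable def sphereGraph (ι : W →ₗᵢ[ℝ] E) (e : E) (x : W) : E :=
  ι x + √(1 - ‖x‖ ^ 2) • e

/-- The component of the gradient at `ξ` which is orthogonal to `ξ`. -/
noncomputable def tangentialGradient [CompleteSpace E] (u : E → ℝ) (ξ : E) : E :=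
  gradient u ξ - ⟪gradient u ξ, ξ⟫ • ξ

theorem ContDiff.continuous_tangentialGradient [CompleteSpace E] {u : E → ℝ}
    (hu : ContDiff ℝ 1 u) : Continuous (tangentialGradient u) := by
  have : Continuous (gradient u) :=
    (InnerProductSpace.toDual ℝ E).symm.continuous.comp (hu.continuous_fderiv one_ne_zero)
  unfold tangentialGradient
  fun_prop

variable {ι : W →ₗᵢ[ℝ] E} {e : E}

theorem continuous_sphereGraph : Continuous (sphereGraph ι e) := by
  have := ι.continuous
  unfold sphereGraph
  fun_prop

theorem norm_sphereGraph (he : ‖e‖ = 1) (hι : ∀ x, ⟪ι x, e⟫ = 0) {x : W} (hx : ‖x‖ ≤ 1) :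
    ‖sphereGraph ι e x‖ = 1 := by
  have h0 : 0 ≤ 1 - ‖x‖ ^ 2 := by nlinarith [norm_nonneg x]
  have : ‖sphereGraph ι e x‖ ^ 2 = 1 := by
    rw [sphereGraph, norm_add_sq_real, inner_smul_right, hι, norm_smul, he, ι.norm_map, mul_pow,
      Real.norm_eq_abs, sq_abs, Real.sq_sqrt h0]
    ring
  exact (sq_eq_sq₀ (norm_nonneg _) zero_le_one).1 (by rw [this, one_pow])

theorem antilipschitzWith_sphereGraph (hι : ∀ x, ⟪ι x, e⟫ = 0) :
    AntilipschitzWith 1 (sphereGraph ι e) := by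
  refine AntilipschitzWith.of_le_mul_dist fun x y => ?_
  rw [NNReal.coe_one, one_mul, dist_eq_norm, dist_eq_norm]
  refine (sq_le_sq₀ (norm_nonneg _) (norm_nonneg _)).1 ?_
  have : sphereGraph ι e x - sphereGraph ι e y =
      ι (x - y) + (√(1 - ‖x‖ ^ 2) - √(1 - ‖y‖ ^ 2)) • e := by
    rw [sphereGraph, sphereGraph, map_sub, sub_smul]; abel
  rw [this, norm_add_sq_real, inner_smul_right, hι, ι.norm_map]
  nlinarith [sq_nonneg ‖(√(1 - ‖x‖ ^ 2) - √(1 - ‖y‖ ^ 2)) • e‖]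

theorem hasFDerivAt_sphereGraph {x : W} (hx : ‖x‖ ^ 2 < 1) :
    HasFDerivAt (sphereGraph ι e)
      (ι.toContinuousLinearMap - ((√(1 - ‖x‖ ^ 2))⁻¹ • innerSL ℝ x).smulRight e) x := by
  have h1 : HasFDerivAt (fun x : W => 1 - ‖x‖ ^ 2) (-(2 • innerSL ℝ x)) x :=
    (hasStrictFDerivAt_norm_sq x).hasFDerivAt.const_sub 1
  have h2 := (h1.sqrt (by linarith)).smul_const e
  have h3 := (ι.toContinuousLinearMap.hasFDerivAt (x := x)).add h2
  refine h3.congr_fderiv ?_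
  ext y
  have : √(1 - ‖x‖ ^ 2) ≠ 0 := (Real.sqrt_pos.2 (by linarith)).ne'
  simp [sub_eq_add_neg, ← neg_smul]
  congr 1
  field_simp

theorem norm_fderiv_sphereGraph_le (he : ‖e‖ = 1) {x : W} (hx : ‖x‖ ^ 2 ≤ 1 / 2) (y : W) :
    ‖(ι.toContinuousLinearMap - ((√(1 - ‖x‖ ^ 2))⁻¹ • innerSL ℝ x).smulRight e) y‖ ≤
      2 * ‖y‖ := by
  have hs : ‖x‖ ≤ √(1 - ‖x‖ ^ 2) := Real.le_sqrt_of_sq_le (by linarith)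
  have hs0 : 0 < √(1 - ‖x‖ ^ 2) := Real.sqrt_pos.2 (by linarith)
  have h1 : ‖((√(1 - ‖x‖ ^ 2))⁻¹ * ⟪x, y⟫) • e‖ ≤ ‖y‖ := by
    rw [norm_smul, he, mul_one, norm_mul, norm_inv, Real.norm_of_nonneg hs0.le,
      inv_mul_le_iff₀ hs0]
    exact (norm_inner_le_norm x y).trans (by gcongr)
  have h2 : (ι.toContinuousLinearMap - ((√(1 - ‖x‖ ^ 2))⁻¹ • innerSL ℝ x).smulRight e) y =
      ι y - ((√(1 - ‖x‖ ^ 2))⁻¹ * ⟪x, y⟫) • e := by simp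
  rw [h2]
  refine (norm_sub_le _ _).trans ?_
  rw [ι.norm_map]
  linarith

theorem lipschitzOnWith_sphereGraph (he : ‖e‖ = 1) :
    LipschitzOnWith 2 (sphereGraph ι e) (closedBall 0 √(1 / 2)) := by
  refine (convex_closedBall _ _).lipschitzOnWith_of_nnnorm_hasFDerivWithin_le
    (fun x hx => (hasFDerivAt_sphereGraph ?_).hasFDerivWithinAt) fun x hx => ?_
  · have := mem_closedBall_sqrt_half.1 hx
    linarith
  · exact ContinuousLinearMap.opNorm_le_bound _ (by norm_num)
      fun y => norm_fderiv_sphereGraph_le he (mem_closedBall_sqrt_half.1 hx) y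

theorem inner_sphereGraph_fderiv (he : ‖e‖ = 1) (hι : ∀ x, ⟪ι x, e⟫ = 0) {x : W}
    (hx : ‖x‖ ^ 2 < 1) (y : W) :
    ⟪sphereGraph ι e x,
      (ι.toContinuousLinearMap - ((√(1 - ‖x‖ ^ 2))⁻¹ • innerSL ℝ x).smulRight e) y⟫ = 0 := by
  have hs0 : √(1 - ‖x‖ ^ 2) ≠ 0 := (Real.sqrt_pos.2 (by linarith)).ne'
  have h' : ∀ x, ⟪e, ι x⟫ = 0 := fun x => by rw [real_inner_comm, hι]
  simp [sphereGraph, inner_add_left, inner_sub_right, inner_smul_left, inner_smul_right, hι, h',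
    he]
  field_simp
  ring

theorem abs_sub_comp_sphereGraph_le [CompleteSpace E] (he : ‖e‖ = 1)
    (hι : ∀ x, ⟪ι x, e⟫ = 0) {u : E → ℝ} (hu : ContDiff ℝ 1 u) {x z : W}
    (hx : x ∈ closedBall 0 √(1 / 2)) (hz : z ∈ closedBall 0 √(1 / 2)) :
    |u (sphereGraph ι e z) - u (sphereGraph ι e x)| ≤
      4 * ∫ t in (0 : ℝ)..1, ‖tangentialGradient u (sphereGraph ι e (x + t • (z - x)))‖ := by
  set γ : ℝ → W := fun t => x + t • (z - x)
  have hγc : Continuous γ := by fun_prop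
  have hγ : ∀ t, HasDerivAt γ (z - x) t := fun t => by
    simpa [γ] using ((hasDerivAt_id t).smul_const (z - x)).const_add x
  have hγK : ∀ t ∈ Icc (0 : ℝ) 1, ‖γ t‖ ^ 2 ≤ 1 / 2 := fun t ht =>
    mem_closedBall_sqrt_half.1 ((convex_closedBall _ _).add_smul_sub_mem hx hz ht)
  set G : ℝ → ℝ := fun t => ‖tangentialGradient u (sphereGraph ι e (γ t))‖
  have hG : Continuous G :=
    (hu.continuous_tangentialGradient.comp (continuous_sphereGraph.comp hγc)).norm
  set D : ℝ → ℝ := fun t => fderiv ℝ u (sphereGraph ι e (γ t))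
    ((ι.toContinuousLinearMap - ((√(1 - ‖γ t‖ ^ 2))⁻¹ • innerSL ℝ (γ t)).smulRight e) (z - x))
  have hder : ∀ t ∈ Icc (0 : ℝ) 1, HasDerivAt (fun t => u (sphereGraph ι e (γ t))) (D t) t :=
    fun t ht => by
    have h1 : HasDerivAt (fun t => sphereGraph ι e (γ t)) _ t :=
      (hasFDerivAt_sphereGraph (by linarith [hγK t ht])).comp_hasDerivAt t (hγ t)
    exact ((hu.differentiable one_ne_zero _).hasFDerivAt).comp_hasDerivAt t h1
  have hzx : ‖z - x‖ ≤ 2 := by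
    have h1 : √(1 / 2) ≤ 1 := Real.sqrt_le_one.2 (by norm_num)
    rw [mem_closedBall_zero_iff] at hx hz
    linarith [norm_sub_le z x]
  have hD : ∀ t ∈ Icc (0 : ℝ) 1, |D t| ≤ 4 * G t := fun t ht => by
    set w := (ι.toContinuousLinearMap -
      ((√(1 - ‖γ t‖ ^ 2))⁻¹ • innerSL ℝ (γ t)).smulRight e) (z - x)
    have h1 : D t = ⟪tangentialGradient u (sphereGraph ι e (γ t)), w⟫ := by
      rw [tangentialGradient, inner_sub_left, inner_smul_left,
        inner_sphereGraph_fderiv he hι (by linarith [hγK t ht]), mul_zero, sub_zero, gradient,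
        InnerProductSpace.toDual_symm_apply]
    rw [h1]
    refine (abs_real_inner_le_norm _ _).trans ?_
    have h2 := norm_fderiv_sphereGraph_le (ι := ι) he (hγK t ht) (z - x)
    have h3 : ‖w‖ ≤ 4 := h2.trans (by linarith)
    rw [mul_comm]
    exact mul_le_mul_of_nonneg_right h3 (norm_nonneg _)
  have hcu : Continuous fun t => u (sphereGraph ι e (γ t)) :=
    hu.continuous.comp (continuous_sphereGraph.comp hγc)
  have hint : IntegrableOn (fun t => 4 * G t) (Icc 0 1) :=
    (hG.const_mul 4).continuousOn.integrableOn_compact isCompact_Icc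
  have up := intervalIntegral.sub_le_integral_of_hasDeriv_right_of_le zero_le_one
    hcu.continuousOn (fun t ht => (hder t (Ioo_subset_Icc_self ht)).hasDerivWithinAt) hint
    fun t ht => (le_abs_self _).trans (hD t (Ioo_subset_Icc_self ht))
  have lo := intervalIntegral.sub_le_integral_of_hasDeriv_right_of_le zero_le_one
    hcu.neg.continuousOn (fun t ht => (hder t (Ioo_subset_Icc_self ht)).neg.hasDerivWithinAt) hint
    fun t ht => (neg_le_abs _).trans (hD t (Ioo_subset_Icc_self ht))
  have g0 : γ 0 = x := by simp [γ]
  have g1 : γ 1 = z := by simp [γ]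
  simp only [g0, g1, Pi.neg_apply, intervalIntegral.integral_const_mul] at up lo
  rw [abs_le]
  constructor <;> linarith

theorem exists_sphereGraph_eq (hsurj : ∀ y, ⟪y, e⟫ = 0 → ∃ x, ι x = y) (he : ‖e‖ = 1)
    {y : E} (hy : ‖y‖ = 1) (hye : √(1 / 2) ≤ ⟪y, e⟫) :
    ∃ x ∈ closedBall (0 : W) √(1 / 2), sphereGraph ι e x = y := by
  set s := ⟪y, e⟫
  have hs0 : 0 ≤ s := (Real.sqrt_nonneg _).trans hye
  have hs : 1 / 2 ≤ s ^ 2 := (Real.sqrt_le_left hs0).1 hye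
  obtain ⟨x, hx⟩ := hsurj (y - s • e) (by
    rw [inner_sub_left, real_inner_smul_left, real_inner_self_eq_norm_sq, he]; simp [s])
  have hn : ‖x‖ ^ 2 = 1 - s ^ 2 := by
    rw [← ι.norm_map, hx, norm_sub_sq_real, hy, inner_smul_right, norm_smul, he, mul_one,
      Real.norm_eq_abs, sq_abs]
    change 1 ^ 2 - 2 * (s * s) + s ^ 2 = _
    ring
  refine ⟨x, mem_closedBall_sqrt_half.2 (by linarith), ?_⟩
  rw [sphereGraph, hn, hx, sub_sub_cancel, Real.sqrt_sq hs0, sub_add_cancel]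

end SphereGraph

section Comparison

open Set

variable {E W : Type*} [NormedAddCommGroup E] [InnerProductSpace ℝ E] [MeasurableSpace E]
  [BorelSpace E] [NormedAddCommGroup W] [InnerProductSpace ℝ W]
  [MeasurableSpace W] [BorelSpace W] {ι : W →ₗᵢ[ℝ] E} {e : E}

theorem map_sphereGraph_hausdorffMeasure_le (he : ‖e‖ = 1) (hι : ∀ x, ⟪ι x, e⟫ = 0) {r : ℝ}
    (hr : 0 ≤ r) :
    (μH[r].restrict (closedBall (0 : W) √(1 / 2))).map (sphereGraph ι e) ≤
      μH[r].restrict (sphere (0 : E) 1) := by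
  have hφ : Continuous (sphereGraph ι e) := continuous_sphereGraph
  refine Measure.le_iff.2 fun s hs => ?_
  rw [Measure.map_apply hφ.measurable hs, Measure.restrict_apply (hφ.measurable hs),
    Measure.restrict_apply hs]
  refine (measure_mono (t := sphereGraph ι e ⁻¹' (s ∩ sphere 0 1)) fun x hx => ⟨hx.1, ?_⟩).trans
    (((antilipschitzWith_sphereGraph hι).hausdorffMeasure_preimage_le hr _).trans (by simp))
  rw [mem_sphere_zero_iff_norm]
  refine norm_sphereGraph he hι ?_
  have := mem_closedBall_sqrt_half.1 hx.2
  nlinarith [norm_nonneg x]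

variable [FiniteDimensional ℝ E]

theorem setIntegral_comp_sphereGraph_le (he : ‖e‖ = 1)
    (hι : ∀ x, ⟪ι x, e⟫ = 0) {r : ℝ} (hr : 0 ≤ r) (hfin : μH[r] (sphere (0 : E) 1) < ⊤)
    {f : E → ℝ} (hf : Continuous f) (h0 : ∀ y, 0 ≤ f y) :
    ∫ x in closedBall (0 : W) √(1 / 2), f (sphereGraph ι e x) ∂μH[r] ≤
      ∫ y in sphere (0 : E) 1, f y ∂μH[r] := by
  rw [← integral_map (f := f) (continuous_sphereGraph (ι := ι)).measurable.aemeasurable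
    hf.aestronglyMeasurable]
  exact integral_mono_measure (map_sphereGraph_hausdorffMeasure_le he hι hr)
    (Filter.Eventually.of_forall h0)
    (hf.continuousOn.integrableOn_of_subset_isCompact (isCompact_sphere _ _)
      isClosed_sphere.measurableSet le_rfl hfin.ne)

variable [FiniteDimensional ℝ W]

theorem hausdorffMeasure_sphere_lt_top
    (hE : ∀ e : E, ‖e‖ = 1 → ∃ ι : W →ₗᵢ[ℝ] E,
      (∀ x, ⟪ι x, e⟫ = 0) ∧ ∀ y, ⟪y, e⟫ = 0 → ∃ x, ι x = y) :
    μH[Module.finrank ℝ W] (sphere (0 : E) 1) < ⊤ := by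
  refine (isCompact_sphere (0 : E) 1).measure_lt_top_of_nhdsWithin fun e he => ?_
  rw [mem_sphere_zero_iff_norm] at he
  obtain ⟨ι, -, hsurj⟩ := hE e he
  refine ⟨sphereGraph ι e '' closedBall 0 √(1 / 2), ?_, ?_⟩
  · have ho : IsOpen {y : E | √(1 / 2) < ⟪y, e⟫} := isOpen_lt (by fun_prop) (by fun_prop)
    have hlt : √(1 / 2) < (1 : ℝ) := (Real.sqrt_lt' one_pos).2 (by norm_num)
    have hme : e ∈ {y : E | √(1 / 2) < ⟪y, e⟫} := by simpa [he] using hlt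
    filter_upwards [self_mem_nhdsWithin, mem_nhdsWithin_of_mem_nhds (ho.mem_nhds hme)]
      with y hy hy2
    exact exists_sphereGraph_eq hsurj he (mem_sphere_zero_iff_norm.1 hy) (le_of_lt hy2)
  · refine ((lipschitzOnWith_sphereGraph he).hausdorffMeasure_image_le
      (Nat.cast_nonneg _)).trans_lt (ENNReal.mul_lt_top ?_ (isCompact_closedBall _ _).measure_lt_top)
    exact ENNReal.rpow_lt_top_of_nonneg (Nat.cast_nonneg _) ENNReal.coe_ne_top

/-- Morrey-type oscillation estimate on the unit sphere, for pairs of orthogonal points. -/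
theorem exists_oscillation_bound_orthogonal (hW : 3 ≤ Module.finrank ℝ W)
    (hE : ∀ e : E, ‖e‖ = 1 → ∃ ι : W →ₗᵢ[ℝ] E,
      (∀ x, ⟪ι x, e⟫ = 0) ∧ ∀ y, ⟪y, e⟫ = 0 → ∃ x, ι x = y) :
    ∃ C : ℝ, 0 < C ∧ ∀ u : E → ℝ, ContDiff ℝ 1 u → ∀ L τ : ℝ, 0 < L → 0 < τ →
      (∀ ξ ∈ sphere (0 : E) 1, ‖tangentialGradient u ξ‖ ≤ L) →
      ∫ ξ in sphere (0 : E) 1, ‖tangentialGradient u ξ‖ ^ 2 ∂μH[Module.finrank ℝ W] ≤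
        τ ^ Module.finrank ℝ W * L ^ 2 →
      ∀ p ∈ sphere (0 : E) 1, ∀ q ∈ sphere (0 : E) 1, ⟪p, q⟫ = 0 →
        |u p - u q| ≤ C * (L * τ) := by
  set μ : Measure W := μH[Module.finrank ℝ W]
  set K : Set W := closedBall 0 √(1 / 2)
  have hK : IsCompact K := isCompact_closedBall _ _
  have hμK : μ K ≠ 0 := (measure_closedBall_pos μ _ (by positivity)).ne'
  have hpos : 0 < μ.real K := ENNReal.toReal_pos hμK hK.measure_ne_top
  refine ⟨2 * 4 * (2 * μ.real K + 1) / μ.real K, by positivity, ?_⟩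
  intro u hu L τ hL hτ hb hI p hp q hq hpq
  rw [mem_sphere_zero_iff_norm] at hp hq
  set a := √(1 / 2)
  have ha : a ^ 2 = 1 / 2 := Real.sq_sqrt (by norm_num)
  have ha0 : 0 ≤ a := Real.sqrt_nonneg _
  set e : E := a • (p + q)
  have he : ‖e‖ = 1 := by
    refine (sq_eq_sq₀ (norm_nonneg _) zero_le_one).1 ?_
    rw [norm_smul, mul_pow, norm_add_sq_real, hp, hq, hpq, Real.norm_eq_abs, sq_abs, ha]
    norm_num
  obtain ⟨ι, hι, hsurj⟩ := hE e he
  have hpe : ⟪p, e⟫ = a := by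
    rw [inner_smul_right, inner_add_right, hpq, real_inner_self_eq_norm_sq, hp]; norm_num
  have hqe : ⟪q, e⟫ = a := by
    rw [inner_smul_right, inner_add_right, real_inner_comm, hpq, real_inner_self_eq_norm_sq, hq]
    norm_num
  obtain ⟨x, hx, hxp⟩ := exists_sphereGraph_eq hsurj he hp hpe.ge
  obtain ⟨y, hy, hyq⟩ := exists_sphereGraph_eq hsurj he hq hqe.ge
  have hφ : Continuous (sphereGraph ι e) := continuous_sphereGraph
  have hT := hu.continuous_tangentialGradient
  have := oscillation_le_of_segment_integral_le μ hW hK (convex_closedBall _ _) hμK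
    (G := fun y => ‖tangentialGradient u (sphereGraph ι e y)‖)
    (v := fun y => u (sphereGraph ι e y)) (by fun_prop) (hu.continuous.comp hφ)
    (by norm_num : (0 : ℝ) ≤ 4)
    (fun x hx z hz => abs_sub_comp_sphereGraph_le he hι hu hx hz) hL hτ
    (fun y hy => hb _ (mem_sphere_zero_iff_norm.2 (norm_sphereGraph he hι (by
      have := mem_closedBall_sqrt_half.1 hy
      nlinarith [norm_nonneg y]))))
    ((setIntegral_comp_sphereGraph_le he hι (Nat.cast_nonneg _)
      (hausdorffMeasure_sphere_lt_top hE) (f := fun y => ‖tangentialGradient u y‖ ^ 2)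
      (by fun_prop) fun y => sq_nonneg _).trans hI) hx hy
  simpa only [hxp, hyq] using this

end Comparison

theorem EuclideanSpace.exists_linearIsometry_onto_orthogonal (d : ℕ)
    (e : EuclideanSpace ℝ (Fin (d + 1))) (he : ‖e‖ = 1) :
    ∃ ι : EuclideanSpace ℝ (Fin d) →ₗᵢ[ℝ] EuclideanSpace ℝ (Fin (d + 1)),
      (∀ x, ⟪ι x, e⟫ = 0) ∧ ∀ y, ⟪y, e⟫ = 0 → ∃ x, ι x = y := by
  have : Fact (Module.finrank ℝ (EuclideanSpace ℝ (Fin (d + 1))) = d + 1) := ⟨by simp⟩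
  have he0 : e ≠ 0 := norm_ne_zero_iff.1 (by rw [he]; exact one_ne_zero)
  let b := (OrthonormalBasis.fromOrthogonalSpanSingleton (𝕜 := ℝ) d he0).repr
  refine ⟨(ℝ ∙ e)ᗮ.subtypeₗᵢ.comp b.symm.toLinearIsometry, fun x => ?_, fun y hy => ?_⟩
  · exact Submodule.mem_orthogonal_singleton_iff_inner_left.1 (b.symm x).2
  · exact ⟨b ⟨y, Submodule.mem_orthogonal_singleton_iff_inner_left.2 hy⟩, by simp⟩

theorem exists_unit_orthogonal_pair {E : Type*} [NormedAddCommGroup E] [InnerProductSpace ℝ E]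
    [FiniteDimensional ℝ E] (hE : 3 ≤ Module.finrank ℝ E) (p q : E) :
    ∃ r : E, ‖r‖ = 1 ∧ ⟪p, r⟫ = 0 ∧ ⟪q, r⟫ = 0 := by
  classical
  set S : Submodule ℝ E := Submodule.span ℝ (({p, q} : Finset E) : Set E)
  have h1 : Module.finrank ℝ S ≤ 2 := (finrank_span_finset_le_card _).trans Finset.card_le_two
  have h2 := S.finrank_add_finrank_orthogonal
  obtain ⟨r, hr, hr0⟩ := Submodule.exists_mem_ne_zero_of_ne_bot
    (show Sᗮ ≠ ⊥ from fun h => by rw [h, finrank_bot] at h2; omega)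
  have hp : ⟪p, r⟫ = 0 := hr p (Submodule.subset_span (by simp))
  have hq : ⟪q, r⟫ = 0 := hr q (Submodule.subset_span (by simp))
  exact ⟨‖r‖⁻¹ • r, norm_smul_inv_norm hr0, by rw [inner_smul_right, hp, mul_zero],
    by rw [inner_smul_right, hq, mul_zero]⟩

/-- A continuous function with zero mean has a nonpositive value. -/
theorem exists_nonpos_of_setIntegral_eq_zero {X : Type*} [TopologicalSpace X] [T2Space X]
    [MeasurableSpace X] [OpensMeasurableSpace X] {μ : Measure X} {s : Set X} (hs : IsCompact s) (hμs : μ s ≠ 0) {f : X → ℝ} (hf : IntegrableOn f s μ)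
    (h : ∫ x in s, f x ∂μ = 0) : ∃ x ∈ s, f x ≤ 0 := by
  by_contra! hc
  have hm := hs.isClosed.measurableSet
  refine ((setIntegral_pos_iff_support_of_nonneg_ae
    ((ae_restrict_mem hm).mono fun x hx => (hc x hx).le) hf).2 ?_).ne' h
  rwa [Set.inter_eq_right.2 (show s ⊆ Function.support f from fun x hx => (hc x hx).ne'),
    pos_iff_ne_zero]

/-- Optimization over the scale `τ` in the oscillation estimate. -/
theorem pow_le_of_forall_scale_bound {d : ℕ} (hd : 2 ≤ d) {M C L J : ℝ} (hM : 0 ≤ M)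
    (hL : 0 ≤ L) (hJ : 0 ≤ J)
    (h : ∀ L' > L, ∀ τ > 0, J ≤ τ ^ d * L' ^ 2 → M ≤ C * (L' * τ)) :
    M ^ d ≤ C ^ d * J * L ^ (d - 2) := by
  have hpow : ∀ ε > 0, M ^ d ≤ C ^ d * (J + ε) * (L + ε) ^ (d - 2) := by
    intro ε hε
    set τ := ((J + ε) / (L + ε) ^ 2) ^ (1 / d : ℝ)
    have hτ : 0 < τ := by positivity
    have hτd : τ ^ d = (J + ε) / (L + ε) ^ 2 := by
      have : (d : ℝ) ≠ 0 := by positivity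
      rw [← Real.rpow_natCast, ← Real.rpow_mul (by positivity), one_div_mul_cancel this,
        Real.rpow_one]
    have hle := h (L + ε) (by linarith) τ hτ
      (by rw [hτd, div_mul_cancel₀ _ (by positivity)]; linarith)
    calc M ^ d ≤ (C * ((L + ε) * τ)) ^ d := by gcongr
      _ = C ^ d * ((L + ε) ^ d * τ ^ d) := by rw [mul_pow, mul_pow]
      _ = C ^ d * ((L + ε) ^ (d - 2) * (L + ε) ^ 2 * ((J + ε) / (L + ε) ^ 2)) := by
          rw [hτd, ← pow_add, Nat.sub_add_cancel hd]
      _ = _ := by field_simp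
  have hlim : Filter.Tendsto (fun ε : ℝ => C ^ d * (J + ε) * (L + ε) ^ (d - 2))
      (nhdsWithin 0 (Set.Ioi 0)) (nhds (C ^ d * J * L ^ (d - 2))) := by
    have : Continuous fun ε : ℝ => C ^ d * (J + ε) * (L + ε) ^ (d - 2) := by fun_prop
    simpa using (this.tendsto 0).mono_left nhdsWithin_le_nhds
  exact ge_of_tendsto hlim (by filter_upwards [self_mem_nhdsWithin] with ε hε using hpow ε hε)

/-- Fuglede-type estimate for `n ≥ 4`: if `u ∈ W^{1,∞}(S^{n-1})` has zero mean over the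
sphere, then `‖u‖_{L^∞}^{n-1} ≤ C(n) ‖∇_τ u‖_{L²}² ‖∇_τ u‖_{L^∞}^{n-3}`. -/
theorem fuglede_sup_bound_high_dim (n : ℕ) (hn : 4 ≤ n) :
    ∃ C : ℝ, 0 < C ∧
      ∀ (u : EuclideanSpace ℝ (Fin n) → ℝ), ContDiff ℝ 1 u →
      ∀ (gradτ : EuclideanSpace ℝ (Fin n) → EuclideanSpace ℝ (Fin n)),
      (∀ ξ ∈ sphere (0 : EuclideanSpace ℝ (Fin n)) 1,
        gradτ ξ = gradient u ξ - ⟪gradient u ξ, ξ⟫ • ξ) →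
      (∫ ξ in sphere (0 : EuclideanSpace ℝ (Fin n)) 1, u ξ ∂(μH[(n : ℝ) - 1])) = 0 →
      (⨆ ξ : sphere (0 : EuclideanSpace ℝ (Fin n)) 1,
          |u (ξ : EuclideanSpace ℝ (Fin n))|) ^ (n - 1) ≤
        C * (∫ ξ in sphere (0 : EuclideanSpace ℝ (Fin n)) 1,
              ‖gradτ ξ‖ ^ 2 ∂(μH[(n : ℝ) - 1])) *
          (⨆ ξ : sphere (0 : EuclideanSpace ℝ (Fin n)) 1,
            ‖gradτ (ξ : EuclideanSpace ℝ (Fin n))‖) ^ (n - 3) := by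
  obtain ⟨d, rfl⟩ : ∃ d, n = d + 1 := ⟨n - 1, by omega⟩
  have hd : 3 ≤ d := by omega
  set S := sphere (0 : EuclideanSpace ℝ (Fin (d + 1))) 1
  have hE := EuclideanSpace.exists_linearIsometry_onto_orthogonal d
  have hfr : Module.finrank ℝ (EuclideanSpace ℝ (Fin d)) = d := by simp
  obtain ⟨C, hC, hosc⟩ := exists_oscillation_bound_orthogonal (by rw [hfr]; exact hd) hE
  have hfin := hausdorffMeasure_sphere_lt_top hE
  have hmap := fun ι e => map_sphereGraph_hausdorffMeasure_le (ι := ι) (e := e)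
    (E := EuclideanSpace ℝ (Fin (d + 1))) (W := EuclideanSpace ℝ (Fin d)) (r := d)
  have hHaar := isAddHaarMeasure_hausdorffMeasure (E := EuclideanSpace ℝ (Fin d))
  rw [hfr] at hosc hfin hHaar
  obtain ⟨e₀, he₀⟩ : ∃ e : EuclideanSpace ℝ (Fin (d + 1)), ‖e‖ = 1 :=
    ⟨EuclideanSpace.single 0 1, by simp⟩
  have hS0 : μH[(d : ℝ)] S ≠ 0 := by
    obtain ⟨ι, hι, -⟩ := hE e₀ he₀
    have h1 := hmap ι e₀ he₀ hι (Nat.cast_nonneg _) Set.univ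
    rw [Measure.map_apply continuous_sphereGraph.measurable .univ, Set.preimage_univ,
      Measure.restrict_apply_univ, Measure.restrict_apply_univ] at h1
    exact ((measure_closedBall_pos _ _ (by positivity)).trans_le h1).ne'
  have hcast : ((d + 1 : ℕ) : ℝ) - 1 = d := by push_cast; ring
  simp only [hcast, show d + 1 - 1 = d by omega, show d + 1 - 3 = d - 2 by omega]
  refine ⟨(2 * C) ^ d, by positivity, fun u hu g hg hmean => ?_⟩
  have hgT : ∀ ξ ∈ S, g ξ = tangentialGradient u ξ := hg
  have hT := hu.continuous_tangentialGradient
  have hSc : IsCompact S := isCompact_sphere _ _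
  have hcS : CompactSpace S := isCompact_iff_compactSpace.1 hSc
  have hne : Nonempty S := ⟨⟨e₀, mem_sphere_zero_iff_norm.2 he₀⟩⟩
  have hm : MeasurableSet S := hSc.isClosed.measurableSet
  rw [setIntegral_congr_fun hm fun ξ hξ => by rw [hgT ξ hξ]]
  have hsup : (⨆ ξ : S, ‖g ξ‖) = ⨆ ξ : S, ‖tangentialGradient u ξ‖ := by
    congr 1; ext ξ; rw [hgT ξ ξ.2]
  rw [hsup]
  set L := ⨆ ξ : S, ‖tangentialGradient u ξ‖
  set J := ∫ ξ in S, ‖tangentialGradient u ξ‖ ^ 2 ∂μH[(d : ℝ)]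
  have hbdd : BddAbove (Set.range fun ξ : S => ‖tangentialGradient u ξ‖) :=
    (isCompact_range (by fun_prop)).bddAbove
  have hL0 : 0 ≤ L := Real.iSup_nonneg fun _ => norm_nonneg _
  have hJ0 : 0 ≤ J := integral_nonneg fun _ => sq_nonneg _
  have hLb : ∀ ξ ∈ S, ‖tangentialGradient u ξ‖ ≤ L := fun ξ hξ => le_ciSup hbdd ⟨ξ, hξ⟩
  have hui : IntegrableOn u S μH[(d : ℝ)] :=
    hu.continuous.continuousOn.integrableOn_of_subset_isCompact hSc hm le_rfl hfin.ne
  obtain ⟨a, haS, ha⟩ := exists_nonpos_of_setIntegral_eq_zero hSc hS0 hui hmean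
  obtain ⟨b, hbS, hb⟩ := exists_nonpos_of_setIntegral_eq_zero hSc hS0 hui.neg
    (by simpa [integral_neg] using hmean)
  refine pow_le_of_forall_scale_bound (by omega) (Real.iSup_nonneg fun _ => abs_nonneg _) hL0 hJ0
    fun L' hL' τ hτ hJ => ciSup_le fun ξ => ?_
  have horth := hosc u hu L' τ (hL0.trans_lt hL') hτ (fun ξ hξ => (hLb ξ hξ).trans hL'.le) hJ
  have hpair : ∀ p ∈ S, ∀ q ∈ S, u p - u q ≤ 2 * C * (L' * τ) := fun p hp q hq => by
    obtain ⟨r, hr, hpr, hqr⟩ := exists_unit_orthogonal_pair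
      (by rw [finrank_euclideanSpace_fin]; omega) p q
    have hrS : r ∈ S := mem_sphere_zero_iff_norm.2 hr
    have h1 := (abs_le.1 (horth p hp r hrS hpr)).2
    have h2 := (abs_le.1 (horth q hq r hrS hqr)).1
    linarith
  have h1 := hpair ξ ξ.2 a haS
  have h2 := hpair b hbS ξ ξ.2
  have hb' : 0 ≤ u b := neg_nonpos.1 hb
  exact abs_le.2 ⟨by linarith, by linarith⟩
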